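/- Let p : ℕ → ℝ with 0 ≤ p(n) ≤ 1 for all n. If p(n)·n → ∞ and (1 - p(n))·n² → ∞ as n → ∞, then asymptotically almost surely a random graph Γ ∈ G(n, p(n)) contains an empty square. -/

import Mathlib

open Finset Filter Topology

attribute [local instance] Classical.propDecidable

/-- The Erdős–Rényi weight of a graph `Γ` on `n` vertices with edge probability `p`:
`p^{E_Γ} (1-p)^{C(n,2) - E_Γ}`. -/
noncomputable def gnpWeight (n : ℕ) (p : ℝ) (Γ : SimpleGraph (Fin n)) : ℝ :=
  p ^ Γ.edgeSet.ncard * (1 - p) ^ (n.choose 2 - Γ.edgeSet.ncard)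

/-- The probability of the event `A` under the Erdős–Rényi model `G(n,p)`. -/
noncomputable def gnpProb (n : ℕ) (p : ℝ) (A : SimpleGraph (Fin n) → Prop) : ℝ :=
  ∑ Γ : SimpleGraph (Fin n), if A Γ then gnpWeight n p Γ else 0

/-- The expectation of a random variable `X` under the Erdős–Rényi model `G(n,p)`. -/
noncomputable def gnpExp (n : ℕ) (p : ℝ) (X : SimpleGraph (Fin n) → ℝ) : ℝ :=
  ∑ Γ : SimpleGraph (Fin n), gnpWeight n p Γ * X Γ

/-- The ordered 4-tuple of distinct vertices `(v₁, v₂, w₁, w₂)` forms an empty square in `Γ`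
with diagonal pairs `{v₁,v₂}` and `{w₁,w₂}`: the four sides are edges, the diagonals are not. -/
def IsEmptySquare {V : Type*} (Γ : SimpleGraph V) (v₁ v₂ w₁ w₂ : V) : Prop :=
  v₁ ≠ v₂ ∧ v₁ ≠ w₁ ∧ v₁ ≠ w₂ ∧ v₂ ≠ w₁ ∧ v₂ ≠ w₂ ∧ w₁ ≠ w₂ ∧
    Γ.Adj v₁ w₁ ∧ Γ.Adj v₁ w₂ ∧ Γ.Adj v₂ w₁ ∧ Γ.Adj v₂ w₂ ∧
    ¬ Γ.Adj v₁ v₂ ∧ ¬ Γ.Adj w₁ w₂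

lemma gnpWeight_nonneg {n : ℕ} {p : ℝ} (h0 : 0 ≤ p) (h1 : p ≤ 1) (Γ : SimpleGraph (Fin n)) :
    0 ≤ gnpWeight n p Γ :=
  mul_nonneg (pow_nonneg h0 _) (pow_nonneg (sub_nonneg.2 h1) _)

/-- A sum over graphs of a function of the edge set is a sum over sets of non-diagonal pairs. -/
lemma sum_simpleGraph_eq_sum_powerset {n : ℕ} (φ : Finset (Sym2 (Fin n)) → ℝ) :
    ∑ Γ : SimpleGraph (Fin n), φ Γ.edgeFinset =
      ∑ s ∈ (⊤ : SimpleGraph (Fin n)).edgeFinset.powerset, φ s := by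
  refine Finset.sum_bij' (fun Γ _ => Γ.edgeFinset)
    (fun s _ => SimpleGraph.fromEdgeSet (s : Set (Sym2 (Fin n)))) ?_ ?_ ?_ ?_ ?_
  · intro Γ _
    rw [Finset.mem_powerset]
    exact SimpleGraph.edgeFinset_mono le_top
  · intro s _
    exact Finset.mem_univ _
  · intro Γ _
    simp
  · intro s hs
    rw [Finset.mem_powerset] at hs
    ext e
    simp only [SimpleGraph.mem_edgeFinset, SimpleGraph.edgeSet_fromEdgeSet, Set.mem_sdiff,
      Finset.mem_coe]
    refine ⟨fun h => h.1, fun h => ⟨h, ?_⟩⟩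
    have := hs h
    simpa using this
  · intro Γ _
    rfl

/-- The probability that all pairs in `F` are edges and no pair in `H` is. -/
lemma gnpProb_edges_nonedges {n : ℕ} (p : ℝ) (F H : Finset (Sym2 (Fin n)))
    (hF : ∀ e ∈ F, ¬ e.IsDiag) (hH : ∀ e ∈ H, ¬ e.IsDiag) (hd : Disjoint F H) :
    gnpProb n p (fun Γ => (∀ e ∈ F, e ∈ Γ.edgeSet) ∧ ∀ e ∈ H, e ∉ Γ.edgeSet) =
      p ^ F.card * (1 - p) ^ H.card := by
  set E := (⊤ : SimpleGraph (Fin n)).edgeFinset with hE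
  have hmem : ∀ e, e ∈ E ↔ ¬ e.IsDiag := by
    intro e
    simp [hE]
  have hFE : F ⊆ E := fun e he => (hmem e).2 (hF e he)
  have hHE : H ⊆ E := fun e he => (hmem e).2 (hH e he)
  have hcard : E.card = n.choose 2 := by
    rw [hE, SimpleGraph.card_edgeFinset_top_eq_card_choose_two, Fintype.card_fin]
  have hprod := Finset.prod_add (fun e => if e ∉ H then p else 0)
    (fun e => if e ∉ F then 1 - p else 0) E
  have hlhs : ∏ e ∈ E, ((if e ∉ H then p else 0) + (if e ∉ F then 1 - p else 0)) =
      p ^ F.card * (1 - p) ^ H.card := by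
    have : ∀ e ∈ E, ((if e ∉ H then p else 0) + (if e ∉ F then 1 - p else 0)) =
        (if e ∈ F then p else 1) * (if e ∈ H then 1 - p else 1) := by
      intro e _
      by_cases h1 : e ∈ F
      · have h2 : e ∉ H := Finset.disjoint_left.1 hd h1
        simp [h1, h2]
      · by_cases h2 : e ∈ H <;> simp [h1, h2]
    rw [Finset.prod_congr rfl this, Finset.prod_mul_distrib, Finset.prod_ite_mem,
      Finset.prod_ite_mem, Finset.inter_eq_right.2 hFE, Finset.inter_eq_right.2 hHE,
      Finset.prod_const, Finset.prod_const]
  rw [← hlhs, hprod, ← sum_simpleGraph_eq_sum_powerset, gnpProb]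
  refine Finset.sum_congr rfl fun Γ _ => ?_
  rw [Finset.prod_ite_zero, Finset.prod_ite_zero, Finset.prod_const, Finset.prod_const]
  have hsub : Γ.edgeFinset ⊆ E := SimpleGraph.edgeFinset_mono le_top
  have hc1 : (∀ e ∈ Γ.edgeFinset, e ∉ H) ↔ ∀ e ∈ H, e ∉ Γ.edgeSet := by
    simp only [SimpleGraph.mem_edgeFinset]
    exact ⟨fun h e he he' => h e he' he, fun h e he he' => h e he' he⟩
  have hc2 : (∀ e ∈ E \ Γ.edgeFinset, e ∉ F) ↔ ∀ e ∈ F, e ∈ Γ.edgeSet := by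
    simp only [Finset.mem_sdiff, SimpleGraph.mem_edgeFinset]
    exact ⟨fun h e he => by_contra fun he' => h e ⟨hFE he, he'⟩ he,
      fun h e he he' => he.2 (h e he')⟩
  have hw : gnpWeight n p Γ =
      p ^ Γ.edgeFinset.card * (1 - p) ^ (E \ Γ.edgeFinset).card := by
    rw [Finset.card_sdiff_of_subset hsub, hcard, gnpWeight, Set.ncard_eq_toFinset_card']
    rfl
  rw [hw]
  simp only [hc1, hc2]
  by_cases a : ∀ e ∈ F, e ∈ Γ.edgeSet
  · by_cases b : ∀ e ∈ H, e ∉ Γ.edgeSet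
    · rw [if_pos ⟨a, b⟩, if_pos b, if_pos a]
    · rw [if_neg fun h => b h.2, if_neg b, zero_mul]
  · rw [if_neg fun h => a h.1, if_neg a, mul_zero]

lemma gnpProb_true (n : ℕ) (p : ℝ) : gnpProb n p (fun _ => True) = 1 := by
  have := gnpProb_edges_nonedges (n := n) p ∅ ∅ (by simp) (by simp) (by simp)
  simpa using this

lemma gnpProb_le_one {n : ℕ} {p : ℝ} (h0 : 0 ≤ p) (h1 : p ≤ 1)
    (A : SimpleGraph (Fin n) → Prop) : gnpProb n p A ≤ 1 := by
  rw [← gnpProb_true n p]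
  refine Finset.sum_le_sum fun Γ _ => ?_
  have := gnpWeight_nonneg h0 h1 Γ
  split_ifs <;> simp_all

/-- Second moment inequality for a finite family of events. -/
lemma sq_sum_gnpProb_le {n : ℕ} {p : ℝ} (h0 : 0 ≤ p) (h1 : p ≤ 1) {ι : Type*} [Fintype ι]
    (A : ι → SimpleGraph (Fin n) → Prop) (B : SimpleGraph (Fin n) → Prop)
    (hAB : ∀ i Γ, A i Γ → B Γ) :
    (∑ i, gnpProb n p (A i)) ^ 2 ≤
      (∑ i, ∑ j, gnpProb n p (fun Γ => A i Γ ∧ A j Γ)) * gnpProb n p B := by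
  set X : SimpleGraph (Fin n) → ℝ := fun Γ => ∑ i, if A i Γ then 1 else 0 with hX
  have e1 : ∑ i, gnpProb n p (A i) = ∑ Γ, gnpWeight n p Γ * X Γ := by
    simp only [gnpProb, hX, Finset.mul_sum, mul_ite, mul_one, mul_zero]
    exact Finset.sum_comm
  have e2 : ∑ i, ∑ j, gnpProb n p (fun Γ => A i Γ ∧ A j Γ) =
      ∑ Γ, gnpWeight n p Γ * X Γ ^ 2 := by
    have : ∀ Γ, gnpWeight n p Γ * X Γ ^ 2 =
        ∑ i, ∑ j, if A i Γ ∧ A j Γ then gnpWeight n p Γ else 0 := by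
      intro Γ
      simp only [hX]
      rw [sq, Finset.sum_mul_sum, Finset.mul_sum]
      refine Finset.sum_congr rfl fun i _ => ?_
      rw [Finset.mul_sum]
      refine Finset.sum_congr rfl fun j _ => ?_
      by_cases a : A i Γ <;> by_cases b : A j Γ <;> simp [a, b]
    simp only [this, gnpProb]
    rw [Finset.sum_comm (s := (Finset.univ : Finset (SimpleGraph (Fin n))))]
    exact Finset.sum_congr rfl fun i _ => by
      rw [Finset.sum_comm]
      congr!
  rw [e1, e2, gnpProb]
  refine Finset.sum_sq_le_sum_mul_sum_of_sq_le_mul _ ?_ ?_ ?_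
  · intro Γ _
    exact mul_nonneg (gnpWeight_nonneg h0 h1 Γ) (sq_nonneg _)
  · intro Γ _
    have := gnpWeight_nonneg h0 h1 Γ
    split_ifs <;> simp_all
  · intro Γ _
    by_cases hB : B Γ
    · simp only [hB, if_true]
      exact le_of_eq (by ring)
    · have : X Γ = 0 := Finset.sum_eq_zero fun i _ => if_neg fun h => hB (hAB i Γ h)
      simp [this]

section Transversal

variable {m n : ℕ}

/-- The four sides of the square with vertices chosen from the four parts
`f (i, ·)`, `i = 0, 1, 2, 3`. -/
noncomputable def transversalSides (f : Fin 4 × Fin m → Fin n)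
    (S : Fin m × Fin m × Fin m × Fin m) : Finset (Sym2 (Fin n)) :=
  {s(f (0, S.1), f (2, S.2.2.1)), s(f (0, S.1), f (3, S.2.2.2)),
    s(f (1, S.2.1), f (2, S.2.2.1)), s(f (1, S.2.1), f (3, S.2.2.2))}

/-- The two diagonals of the square with vertices chosen from the four parts
`f (i, ·)`, `i = 0, 1, 2, 3`. -/
noncomputable def transversalDiagonals (f : Fin 4 × Fin m → Fin n)
    (S : Fin m × Fin m × Fin m × Fin m) : Finset (Sym2 (Fin n)) :=
  {s(f (0, S.1), f (1, S.2.1)), s(f (2, S.2.2.1), f (3, S.2.2.2))}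

/-- The event that the transversal `S` spans an empty square. -/
def TransversalSquare (f : Fin 4 × Fin m → Fin n)
    (S : Fin m × Fin m × Fin m × Fin m) (Γ : SimpleGraph (Fin n)) : Prop :=
  (∀ e ∈ transversalSides f S, e ∈ Γ.edgeSet) ∧ ∀ e ∈ transversalDiagonals f S, e ∉ Γ.edgeSet

lemma TransversalSquare.exists_isEmptySquare {f : Fin 4 × Fin m → Fin n}
    (hf : Function.Injective f) {S : Fin m × Fin m × Fin m × Fin m} {Γ : SimpleGraph (Fin n)}
    (h : TransversalSquare f S Γ) : ∃ v₁ v₂ w₁ w₂, IsEmptySquare Γ v₁ v₂ w₁ w₂ := by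
  refine ⟨f (0, S.1), f (1, S.2.1), f (2, S.2.2.1), f (3, S.2.2.2), ?_⟩
  simp only [TransversalSquare, transversalSides, transversalDiagonals, Finset.mem_insert,
    Finset.mem_singleton, forall_eq_or_imp, forall_eq, SimpleGraph.mem_edgeSet] at h
  simp [IsEmptySquare, hf.eq_iff, h]

/-- `x` if `A` holds and `1` otherwise. -/
noncomputable def overlapFactor (A : Prop) (x : ℝ) : ℝ :=
  if A then x else 1

/-- `1` if `A` holds and `0` otherwise. -/
noncomputable def propIndicator (A : Prop) : ℝ :=
  if A then 1 else 0

lemma pow_card_pair {α : Type*} [DecidableEq α] (x : ℝ) (hx : x ≠ 0) (a b : α) :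
    x ^ ({a, b} : Finset α).card = x ^ 2 * overlapFactor (a = b) x⁻¹ := by
  by_cases h : a = b
  · subst h
    simp [overlapFactor, sq, hx]
  · simp [overlapFactor, h, Finset.card_pair h]

lemma gnpProb_transversalSquare_and {p : ℝ} (hp : p ≠ 0) (hq : 1 - p ≠ 0)
    {f : Fin 4 × Fin m → Fin n} (hf : Function.Injective f) (a b c d a' b' c' d' : Fin m) :
    gnpProb n p (fun Γ => TransversalSquare f (a, b, c, d) Γ ∧
        TransversalSquare f (a', b', c', d') Γ) =
      p ^ 8 * (1 - p) ^ 4 *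
        (overlapFactor (a = a' ∧ c = c') p⁻¹ * overlapFactor (a = a' ∧ d = d') p⁻¹ *
        overlapFactor (b = b' ∧ c = c') p⁻¹ * overlapFactor (b = b' ∧ d = d') p⁻¹ *
        overlapFactor (a = a' ∧ b = b') (1 - p)⁻¹ *
        overlapFactor (c = c' ∧ d = d') (1 - p)⁻¹) := by
  set F : Finset (Sym2 (Fin n)) :=
    {s(f (0, a), f (2, c)), s(f (0, a'), f (2, c'))} ∪
    ({s(f (0, a), f (3, d)), s(f (0, a'), f (3, d'))} ∪
    ({s(f (1, b), f (2, c)), s(f (1, b'), f (2, c'))} ∪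
    {s(f (1, b), f (3, d)), s(f (1, b'), f (3, d'))})) with hF
  set H : Finset (Sym2 (Fin n)) :=
    {s(f (0, a), f (1, b)), s(f (0, a'), f (1, b'))} ∪
    {s(f (2, c), f (3, d)), s(f (2, c'), f (3, d'))} with hH
  have hFc : p ^ F.card = p ^ 8 *
      (overlapFactor (a = a' ∧ c = c') p⁻¹ * overlapFactor (a = a' ∧ d = d') p⁻¹ *
        overlapFactor (b = b' ∧ c = c') p⁻¹ * overlapFactor (b = b' ∧ d = d') p⁻¹) := by
    rw [hF, Finset.card_union_of_disjoint, Finset.card_union_of_disjoint,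
      Finset.card_union_of_disjoint, pow_add, pow_add, pow_add]
    · simp only [pow_card_pair _ hp, Sym2.eq_iff, hf.eq_iff, Prod.mk.injEq]
      simp
      ring
    all_goals simp [hf.eq_iff]
  have hHc : (1 - p) ^ H.card = (1 - p) ^ 4 *
      (overlapFactor (a = a' ∧ b = b') (1 - p)⁻¹ *
        overlapFactor (c = c' ∧ d = d') (1 - p)⁻¹) := by
    rw [hH, Finset.card_union_of_disjoint, pow_add]
    · simp only [pow_card_pair _ hq, Sym2.eq_iff, hf.eq_iff, Prod.mk.injEq]
      simp
      ring
    all_goals simp [hf.eq_iff]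
  have key := gnpProb_edges_nonedges p F H (by simp [hF, hf.eq_iff]) (by simp [hH, hf.eq_iff])
    (by simp [hF, hH, hf.eq_iff])
  have hev : (fun Γ => TransversalSquare f (a, b, c, d) Γ ∧
        TransversalSquare f (a', b', c', d') Γ) =
      (fun Γ : SimpleGraph (Fin n) => (∀ e ∈ F, e ∈ Γ.edgeSet) ∧ ∀ e ∈ H, e ∉ Γ.edgeSet) := by
    funext Γ
    simp only [TransversalSquare, transversalSides, transversalDiagonals, hF, hH,
      Finset.mem_union, Finset.mem_insert, Finset.mem_singleton, or_imp, forall_and, forall_eq,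
      eq_iff_iff]
    tauto
  rw [hev, key, hFc, hHc]
  ring

lemma gnpProb_transversalSquare {p : ℝ} (hp : p ≠ 0) (hq : 1 - p ≠ 0)
    {f : Fin 4 × Fin m → Fin n} (hf : Function.Injective f)
    (S : Fin m × Fin m × Fin m × Fin m) :
    gnpProb n p (TransversalSquare f S) = p ^ 4 * (1 - p) ^ 2 := by
  obtain ⟨a, b, c, d⟩ := S
  have := gnpProb_transversalSquare_and hp hq hf a b c d a b c d
  simp only [overlapFactor, and_self, if_true] at this
  rw [this]
  field_simp

/-- The overlap factor of two transversal squares is bounded by a sum over the possible sets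
of common vertices. -/
lemma overlap_le {P Q : ℝ} (hP : 0 ≤ P) (hQ : 0 ≤ Q) (A B C D : Prop) :
    overlapFactor (A ∧ C) P * overlapFactor (A ∧ D) P * overlapFactor (B ∧ C) P *
      overlapFactor (B ∧ D) P * overlapFactor (A ∧ B) Q * overlapFactor (C ∧ D) Q ≤
    1 + P * (propIndicator A * propIndicator C
        + propIndicator A * propIndicator D
        + propIndicator B * propIndicator C
        + propIndicator B * propIndicator D)
      + Q * (propIndicator A * propIndicator B
        + propIndicator C * propIndicator D)
      + P ^ 2 * Q * (propIndicator A * propIndicator B * propIndicator C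
        + propIndicator A * propIndicator B * propIndicator D
        + propIndicator A * propIndicator C * propIndicator D
        + propIndicator B * propIndicator C * propIndicator D)
      + P ^ 4 * Q ^ 2 * (propIndicator A * propIndicator B * propIndicator C
        * propIndicator D) := by
  have h1 : 0 ≤ P ^ 2 * Q := by positivity
  have h2 : 0 ≤ P ^ 4 * Q ^ 2 := by positivity
  by_cases hA : A <;> by_cases hB : B <;> by_cases hC : C <;> by_cases hD : D <;>
    simp only [overlapFactor, propIndicator, hA, hB, hC, hD, and_self, and_true, and_false, if_true,
      if_false] <;>
    linarith

lemma sum_gnpProb_transversalSquare_and_le {p : ℝ} (hp : 0 < p) (hq : 0 < 1 - p)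
    {f : Fin 4 × Fin m → Fin n} (hf : Function.Injective f)
    (S : Fin m × Fin m × Fin m × Fin m) :
    ∑ T, gnpProb n p (fun Γ => TransversalSquare f S Γ ∧ TransversalSquare f T Γ) ≤
      p ^ 8 * (1 - p) ^ 4 * ((m : ℝ) ^ 4 + 4 * p⁻¹ * (m : ℝ) ^ 2 + 2 * (1 - p)⁻¹ * (m : ℝ) ^ 2
        + 4 * (p⁻¹ ^ 2 * (1 - p)⁻¹) * m + p⁻¹ ^ 4 * (1 - p)⁻¹ ^ 2) := by
  obtain ⟨a, b, c, d⟩ := S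
  simp only [Fintype.sum_prod_type, gnpProb_transversalSquare_and hp.ne' hq.ne' hf,
    ← Finset.mul_sum]
  refine mul_le_mul_of_nonneg_left ?_ (by positivity)
  refine (Finset.sum_le_sum fun a' _ => Finset.sum_le_sum fun b' _ => Finset.sum_le_sum
    fun c' _ => Finset.sum_le_sum fun d' _ => overlap_le (inv_nonneg.2 hp.le)
      (inv_nonneg.2 hq.le) (a = a') (b = b') (c = c') (d = d')).trans (le_of_eq ?_)
  have hone : ∀ x : Fin m, ∑ y, propIndicator (x = y) = 1 := fun x =>
    (Finset.sum_eq_single x (fun y _ hy => if_neg hy.symm)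
      (fun hx => absurd (Finset.mem_univ x) hx)).trans (if_pos rfl)
  simp only [Finset.sum_add_distrib, ← Finset.mul_sum, ← Finset.sum_mul, hone, Finset.sum_const,
    Finset.card_univ, Fintype.card_fin, nsmul_eq_mul]
  ring

end Transversal

/-- The second moment lower bound for the probability of an empty square. -/
lemma one_le_mul_gnpProb_emptySquare {m n : ℕ} (hm : 0 < m) (hmn : 4 * m ≤ n) {p : ℝ}
    (hp : 0 < p) (hq : 0 < 1 - p) :
    1 ≤ (1 + 4 * ((m : ℝ) ^ 2 * p)⁻¹ + 2 * ((m : ℝ) ^ 2 * (1 - p))⁻¹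
        + 4 * ((m : ℝ) ^ 3 * p ^ 2 * (1 - p))⁻¹ + ((m : ℝ) ^ 4 * p ^ 4 * (1 - p) ^ 2)⁻¹) *
      gnpProb n p (fun Γ => ∃ v₁ v₂ w₁ w₂ : Fin n, IsEmptySquare Γ v₁ v₂ w₁ w₂) := by
  set R := gnpProb n p (fun Γ => ∃ v₁ v₂ w₁ w₂ : Fin n, IsEmptySquare Γ v₁ v₂ w₁ w₂) with hR
  have hR0 : 0 ≤ R := Finset.sum_nonneg fun Γ _ => by
    have := gnpWeight_nonneg hp.le (sub_nonneg.1 hq.le) Γ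
    split_ifs <;> simp_all
  set f : Fin 4 × Fin m → Fin n := fun x => Fin.castLE hmn (finProdFinEquiv x)
  have hf : Function.Injective f :=
    (Fin.castLE_injective hmn).comp finProdFinEquiv.injective
  have h2 := sq_sum_gnpProb_le hp.le (sub_nonneg.1 hq.le) (TransversalSquare f)
    (fun Γ => ∃ v₁ v₂ w₁ w₂ : Fin n, IsEmptySquare Γ v₁ v₂ w₁ w₂)
    (fun S Γ h => h.exists_isEmptySquare hf)
  rw [← hR] at h2
  have h3 := h2.trans (mul_le_mul_of_nonneg_right
    (Finset.sum_le_sum fun S _ => sum_gnpProb_transversalSquare_and_le hp hq hf S) hR0)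
  simp only [gnpProb_transversalSquare hp.ne' hq.ne' hf, Finset.sum_const, Finset.card_univ,
    Fintype.card_prod, Fintype.card_fin, nsmul_eq_mul, Nat.cast_mul] at h3
  have hm' : (0 : ℝ) < m := Nat.cast_pos.2 hm
  have hpos : 0 < (m : ℝ) ^ 8 * p ^ 8 * (1 - p) ^ 4 := by positivity
  refine le_of_mul_le_mul_left ?_ hpos
  calc _ = _ := by ring
    _ ≤ _ := h3
    _ = _ := by
      field_simp

/-- If `p n * n → ∞` and `(1 - p n) * n ^ 2 → ∞` along a sequence `m`, then
`m ^ 2 * p ^ 2 * (1 - p) → ∞`. -/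
lemma tendsto_sq_mul_sq_mul_atTop {m p : ℕ → ℝ} (hp : ∀ n, 0 ≤ p n ∧ p n ≤ 1)
    (h1 : Tendsto (fun n => m n * p n) atTop atTop)
    (h2 : Tendsto (fun n => m n ^ 2 * (1 - p n)) atTop atTop) :
    Tendsto (fun n => m n ^ 2 * p n ^ 2 * (1 - p n)) atTop atTop := by
  rw [tendsto_atTop]
  intro b
  filter_upwards [h1.eventually_ge_atTop 1, h1.eventually_ge_atTop (2 * b),
    h2.eventually_ge_atTop (4 * b), h2.eventually_ge_atTop 0] with n ha hb hc hd
  obtain ⟨h0, h1⟩ := hp n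
  rcases le_total (p n) (1 / 2) with h | h
  · have : 1 / 2 * (m n * p n) ^ 2 ≤ m n ^ 2 * p n ^ 2 * (1 - p n) := by
      nlinarith [sq_nonneg (m n * p n)]
    nlinarith
  · have : 1 / 4 ≤ p n ^ 2 := by nlinarith
    nlinarith

/-- If `p(n)·n → ∞` and `(1-p(n))·n² → ∞`, then a.a.s. `Γ ∈ G(n, p(n))` contains an
empty square. -/
theorem gnp_aas_empty_square (p : ℕ → ℝ) (hp : ∀ n, 0 ≤ p n ∧ p n ≤ 1)
    (h1 : Tendsto (fun n : ℕ => p n * (n : ℝ)) atTop atTop)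
    (h2 : Tendsto (fun n : ℕ => (1 - p n) * (n : ℝ) ^ 2) atTop atTop) :
    Tendsto (fun n : ℕ =>
      gnpProb n (p n) (fun Γ => ∃ v₁ v₂ w₁ w₂ : Fin n, IsEmptySquare Γ v₁ v₂ w₁ w₂))
      atTop (nhds 1) := by
  set m : ℕ → ℝ := fun n => ((n / 4 : ℕ) : ℝ) with hm
  have hm_ge : ∀ᶠ n : ℕ in atTop, (n : ℝ) / 8 ≤ m n := by
    filter_upwards [eventually_ge_atTop 4] with n hn
    have : n ≤ 8 * (n / 4) := by omega
    have : (n : ℝ) ≤ 8 * ((n / 4 : ℕ) : ℝ) := by exact_mod_cast this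
    simp only [hm]
    linarith
  have hm_top : Tendsto m atTop atTop :=
    tendsto_atTop_mono' _ hm_ge (tendsto_natCast_atTop_atTop.atTop_div_const (by norm_num))
  have hx : Tendsto (fun n => m n * p n) atTop atTop := by
    refine tendsto_atTop_mono' _ ?_ (h1.atTop_div_const (by norm_num : (0 : ℝ) < 8))
    filter_upwards [hm_ge] with n hn
    nlinarith [(hp n).1]
  have hy : Tendsto (fun n => m n ^ 2 * (1 - p n)) atTop atTop := by
    refine tendsto_atTop_mono' _ ?_ (h2.atTop_div_const (by norm_num : (0 : ℝ) < 64))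
    filter_upwards [hm_ge] with n hn
    have h8 : ((n : ℝ) / 8) ^ 2 ≤ m n ^ 2 := pow_le_pow_left₀ (by positivity) hn 2
    nlinarith [(hp n).2]
  have hz := tendsto_sq_mul_sq_mul_atTop hp hx hy
  have t1 : Tendsto (fun n => (m n ^ 2 * p n)⁻¹) atTop (nhds 0) :=
    ((hm_top.atTop_mul_atTop₀ hx).congr fun n => by ring).inv_tendsto_atTop
  have t2 : Tendsto (fun n => (m n ^ 2 * (1 - p n))⁻¹) atTop (nhds 0) := hy.inv_tendsto_atTop
  have t3 : Tendsto (fun n => (m n ^ 3 * p n ^ 2 * (1 - p n))⁻¹) atTop (nhds 0) :=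
    ((hm_top.atTop_mul_atTop₀ hz).congr fun n => by ring).inv_tendsto_atTop
  have t4 : Tendsto (fun n => (m n ^ 4 * p n ^ 4 * (1 - p n) ^ 2)⁻¹) atTop (nhds 0) :=
    ((hz.atTop_mul_atTop₀ hz).congr fun n => by ring).inv_tendsto_atTop
  have hsum := ((((t1.const_mul 4).const_add 1).add
    (t2.const_mul 2)).add (t3.const_mul 4)).add t4
  have hinv := hsum.inv₀ (by norm_num)
  simp only [mul_zero, add_zero, inv_one] at hinv
  refine tendsto_of_tendsto_of_tendsto_of_le_of_le' hinv tendsto_const_nhds ?_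
    (Eventually.of_forall fun n => gnpProb_le_one (hp n).1 (hp n).2 _)
  filter_upwards [hx.eventually_gt_atTop 0, hy.eventually_gt_atTop 0,
    hm_top.eventually_gt_atTop 0] with n hxn hyn hmn
  have hp0 : 0 < p n := pos_of_mul_pos_right hxn hmn.le
  have hq0 : 0 < 1 - p n := pos_of_mul_pos_right hyn (by positivity)
  have key := one_le_mul_gnpProb_emptySquare (m := n / 4) (n := n) (Nat.cast_pos.1 hmn)
    (by omega) hp0 hq0
  exact (inv_le_iff_one_le_mul₀' (by positivity)).2 key
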